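/- arXiv:1711.01884 — 2 statements merged into one kernel-verified Lean document; each statement's English description precedes it below -/
import Mathlib

section
/- Let 0 < λ < η and set ϑ = (λ/η)^(1/(q−2)). Then ϑ ∈ (0,1), and for every u > 0 one has ϑ·(λ·u^(q−1) − f(u)) ≤ η·(ϑ·u)^(q−1) − f(ϑ·u). -/
/-- Let 0 < λ < η and ϑ = (λ/η)^(1/(q−2)).  Then ϑ ∈ (0,1)
and for every u > 0, ϑ·(λ·u^(q−1) − f(u)) ≤ η·(ϑ·u)^(q−1) − f(ϑ·u).
Here q > 2, x ↦ f(x)/x is nondecreasing on (0,∞), and f ≥ 0 on [0,∞). -/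
theorem stmt_5 (q : ℝ) (hq : 2 < q) (f : ℝ → ℝ)
    (hf_mono : ∀ x y : ℝ, 0 < x → x ≤ y → f x / x ≤ f y / y)
    (hf_nonneg : ∀ x : ℝ, 0 ≤ x → 0 ≤ f x)
    (lam η : ℝ) (hlam : 0 < lam) (hlamη : lam < η)
    (ϑ : ℝ) (hϑ : ϑ = (lam / η) ^ (1 / (q - 2))) :
    (0 < ϑ ∧ ϑ < 1) ∧
      ∀ u : ℝ, 0 < u →
        ϑ * (lam * u ^ (q - 1) - f u) ≤ η * (ϑ * u) ^ (q - 1) - f (ϑ * u) := by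
  have hη : 0 < η := hlam.trans hlamη
  have hq2 : 0 < q - 2 := by linarith
  have hdiv : 0 < lam / η := div_pos hlam hη
  have hpos : 0 < ϑ := hϑ ▸ Real.rpow_pos_of_pos hdiv _
  have hlt : ϑ < 1 :=
    hϑ ▸ Real.rpow_lt_one hdiv.le ((div_lt_one hη).2 hlamη) (one_div_pos.2 hq2)
  refine ⟨⟨hpos, hlt⟩, fun u hu => ?_⟩
  have hpow : ϑ ^ (q - 2) = lam / η := by
    rw [hϑ, ← Real.rpow_mul hdiv.le, one_div_mul_cancel hq2.ne', Real.rpow_one]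
  have hscale : η * (ϑ * u) ^ (q - 1) = ϑ * (lam * u ^ (q - 1)) := by
    rw [Real.mul_rpow hpos.le hu.le, show ϑ ^ (q - 1) = ϑ ^ (q - 2) * ϑ by
      rw [← Real.rpow_add_one hpos.ne']; congr 1; ring, hpow]
    field_simp
  have hf : f (ϑ * u) ≤ ϑ * f u := by
    have h := hf_mono (ϑ * u) u (by positivity) (mul_le_of_le_one_left hu.le hlt.le)
    rw [div_le_iff₀ (by positivity)] at h
    calc f (ϑ * u) ≤ f u / u * (ϑ * u) := h
      _ = ϑ * f u := by field_simp
  rw [hscale, mul_sub]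
  linarith
end

section
/- Let q ∈ ℝ with q > 2 and define f : ℝ → ℝ by f(x) = x^(q−1)·(log(1+x) + (1/q)·x/(1+x)) for x ≥ 0 and f(x) = 0 for x < 0. Then for every ρ > 0 there exists ξ_ρ > 0 such that the map x ↦ ξ_ρ·x − f(x) is nondecreasing on [0, ρ]. -/
open Real

/-- For q > 2 and f(x) = x^(q−1)·(log(1+x) + (1/q)·x/(1+x))
on [0,∞) (and 0 for x < 0): for every ρ > 0 there exists ξ_ρ > 0 such that
x ↦ ξ_ρ·x − f(x) is nondecreasing on [0,ρ]. -/
theorem stmt_10 (q : ℝ) (hq : 2 < q) (f : ℝ → ℝ)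
    (hf : ∀ x : ℝ, f x =
      if 0 ≤ x then x ^ (q - 1) * (Real.log (1 + x) + (1 / q) * (x / (1 + x))) else 0) :
    ∀ ρ : ℝ, 0 < ρ → ∃ ξ : ℝ, 0 < ξ ∧
      ∀ x y : ℝ, 0 ≤ x → x ≤ y → y ≤ ρ → ξ * x - f x ≤ ξ * y - f y := by
  intro ρ _
  have hne : ∀ x ∈ Set.Icc 0 ρ, 1 + x ≠ 0 := fun x hx => by linarith [hx.1]
  have hadd : ContDiffOn ℝ 1 (fun x : ℝ => 1 + x) (Set.Icc 0 ρ) :=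
    contDiffOn_const.add contDiffOn_id
  have hpow : ContDiffOn ℝ 1 (fun x : ℝ => x ^ (q - 1)) (Set.Icc 0 ρ) :=
    (contDiff_rpow_const_of_le (n := 1) (by push_cast; linarith)).contDiffOn
  have hcd : ContDiffOn ℝ 1 f (Set.Icc 0 ρ) :=
    (hpow.mul ((hadd.log hne).add
      (contDiffOn_const.mul (contDiffOn_id.div hadd hne)))).congr
      fun x hx => (hf x).trans (if_pos hx.1)
  obtain ⟨K, hK⟩ := hcd.exists_lipschitzOnWith one_ne_zero (convex_Icc 0 ρ) isCompact_Icc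
  refine ⟨K + 1, by positivity, fun x y hx hxy hy => ?_⟩
  have hdist := hK.dist_le_mul y ⟨hx.trans hxy, hy⟩ x ⟨hx, hxy.trans hy⟩
  rw [Real.dist_eq, Real.dist_eq, abs_of_nonneg (sub_nonneg.2 hxy)] at hdist
  linarith [le_abs_self (f y - f x)]
end
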